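/- General multilinear counting estimate (Lemma 3.3): Let 1 < α ≤ 2 and let k ≥ 3 be an integer. For every choice of signs ε_sum, ε_1, …, ε_k ∈ {−1, +1} there exists a constant C = C(α, k) > 0 (uniform in the sign choice) such that for all dyadic numbers N_1, …, N_k ≥ 1 and every ζ ∈ ℝ, the cardinality of the set { (n_1, …, n_k) ∈ (ℤ³)^k : |n_j| ∼ N_j for each j, and |κ(n_1, …, n_k) − ζ| ≤ 1 } is at most C · (max_(2){N_1, …, N_k})^{−1} · Π_{j=1}^k N_j³. -/

import Mathlib

noncomputable section

open scoped BigOperators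

/-- Japanese bracket of a real number: `⟨x⟩ = (1 + x²)^{1/2}`. -/
def rjb (x : ℝ) : ℝ := Real.sqrt (1 + x ^ 2)

/-- Euclidean norm of a lattice point in `ℤ³`. -/
def znorm (n : Fin 3 → ℤ) : ℝ := Real.sqrt (∑ i, ((n i : ℝ)) ^ 2)

/-- Japanese bracket `⟨n⟩ = (1 + |n|²)^{1/2}` of a lattice point in `ℤ³`. -/
def jb (n : Fin 3 → ℤ) : ℝ := Real.sqrt (1 + ∑ i, ((n i : ℝ)) ^ 2)

/-- The modified bracket `⟪n⟫ = (⟨n⟩^{2α} − 1/4)^{1/2}`. -/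
def jbb (α : ℝ) (n : Fin 3 → ℤ) : ℝ := Real.sqrt (jb n ^ (2 * α) - 1 / 4)

/-- Dyadic numbers `2^j`, `j ≥ 0`. -/
def IsDyadic (N : ℝ) : Prop := ∃ j : ℕ, N = 2 ^ j

/-- `|n| ∼ N` for a dyadic number `N`: `N/2 < |n| ≤ N` if `N ≥ 2`, and `|n| ≤ 1` if `N = 1`. -/
def SimFreq (N : ℝ) (n : Fin 3 → ℤ) : Prop :=
  (2 ≤ N ∧ N / 2 < znorm n ∧ znorm n ≤ N) ∨ (N < 2 ∧ znorm n ≤ 1)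

/-- `x` is a sign `±1`. -/
def IsSign (x : ℝ) : Prop := x = 1 ∨ x = -1

open Classical in
/-- Real-valued indicator of a proposition. -/
def ind (p : Prop) : ℝ := if p then 1 else 0

/-- The phase `κ(n₁,…,n_k) = ε_sum ⟪n₁+⋯+n_k⟫ + Σ_j ε_j ⟪n_j⟫`. -/
def phase (α : ℝ) {k : ℕ} (εsum : ℝ) (ε : Fin k → ℝ) (n : Fin k → Fin 3 → ℤ) : ℝ :=
  εsum * jbb α (∑ j, n j) + ∑ j, ε j * jbb α (n j)

/-- The second largest entry of a finite tuple of reals (with multiplicity). -/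
def secondMax {k : ℕ} (Nv : Fin k → ℝ) : ℝ :=
  sSup {x : ℝ | ∃ i j : Fin k, i ≠ j ∧ x = min (Nv i) (Nv j)}

/-- Up to the factor `α`, the gradient of `x ↦ ‖x‖ ^ α`. -/
def powGrad {E : Type*} [NormedAddCommGroup E] [InnerProductSpace ℝ E] (α : ℝ) (x : E) : E :=
  ‖x‖ ^ (α - 2) • x

lemma rpow_sub_two_mul_bounds {α a b : ℝ} (hα₁ : 1 < α) (hα₂ : α ≤ 2) (hb : 0 ≤ b) (hab : b ≤ a) :
    0 ≤ (b ^ (α - 2) - a ^ (α - 2)) * b ∧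
      (b ^ (α - 2) - a ^ (α - 2)) * b ≤ (2 - α) * a ^ (α - 2) * (a - b) := by
  rcases hb.eq_or_lt with rfl | hb
  · have := Real.rpow_nonneg hab (α - 2)
    refine ⟨by simp, ?_⟩
    simp only [mul_zero, sub_zero]
    have : 0 ≤ 2 - α := by linarith
    positivity
  have ha : 0 < a := hb.trans_le hab
  refine ⟨mul_nonneg (sub_nonneg.2
    (Real.rpow_le_rpow_of_nonpos hb hab (by linarith))) hb.le, ?_⟩
  have h1 := rpow_one_add_le_one_add_mul_self (s := b / a - 1) (p := α - 1)
    (by have := div_pos hb ha; linarith) (by linarith) (by linarith)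
  rw [add_sub_cancel, Real.div_rpow hb.le ha.le] at h1
  have e : ∀ c : ℝ, 0 < c → c ^ (α - 1) = c ^ (α - 2) * c := fun c hc => by
    rw [← Real.rpow_add_one hc.ne']; ring_nf
  have hp : 0 < a ^ (α - 1) := by positivity
  rw [div_le_iff₀ hp, e a ha, e b hb] at h1
  have h2 : (1 + (α - 1) * (b / a - 1)) * (a ^ (α - 2) * a)
      = a ^ (α - 2) * (a + (α - 1) * (b - a)) := by field_simp
  rw [h2] at h1
  linarith

section InnerProduct

variable {E : Type*} [NormedAddCommGroup E] [InnerProductSpace ℝ E]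

lemma powGrad_sub_bounds {α : ℝ} (hα₁ : 1 < α) (hα₂ : α ≤ 2) {x y : E} (hxy : ‖y‖ ≤ ‖x‖) :
    (α - 1) * ‖x‖ ^ (α - 2) * ‖x - y‖ ^ 2 ≤ inner ℝ (x - y) (powGrad α x - powGrad α y) ∧
      ‖powGrad α x - powGrad α y‖ ≤ 2 * ‖x‖ ^ (α - 2) * ‖x - y‖ := by
  obtain ⟨h0, h1⟩ := rpow_sub_two_mul_bounds hα₁ hα₂ (norm_nonneg y) hxy
  set p := ‖x‖ ^ (α - 2) with hp
  set κ := ‖y‖ ^ (α - 2) - p with hκ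
  have hp0 : 0 ≤ p := Real.rpow_nonneg (norm_nonneg _) _
  have hF : powGrad α x - powGrad α y = p • (x - y) - κ • y := by
    simp only [powGrad, hκ, ← hp]
    module
  have hd : ‖x‖ - ‖y‖ ≤ ‖x - y‖ := norm_sub_norm_le x y
  have hd0 : 0 ≤ ‖x‖ - ‖y‖ := sub_nonneg.2 hxy
  rw [hF]
  constructor
  · rw [inner_sub_right, real_inner_smul_right, real_inner_smul_right,
      real_inner_self_eq_norm_sq]
    have h3 : inner ℝ (x - y) y ≤ (‖x‖ - ‖y‖) * ‖y‖ := by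
      rw [inner_sub_left, real_inner_self_eq_norm_sq]
      nlinarith [real_inner_le_norm x y]
    have h4 : κ * inner ℝ (x - y) y ≤ κ * ‖y‖ * (‖x‖ - ‖y‖) := by
      rcases eq_or_ne y 0 with rfl | hy
      · simp
      · have : 0 ≤ κ := nonneg_of_mul_nonneg_left h0 (norm_pos_iff.2 hy)
        nlinarith
    have h5 : κ * ‖y‖ * (‖x‖ - ‖y‖) ≤ (2 - α) * p * (‖x‖ - ‖y‖) * (‖x‖ - ‖y‖) :=
      mul_le_mul_of_nonneg_right h1 hd0
    have h6 : (‖x‖ - ‖y‖) * (‖x‖ - ‖y‖) ≤ ‖x - y‖ ^ 2 := by nlinarith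
    have h7 : 0 ≤ (2 - α) * p := mul_nonneg (by linarith) hp0
    nlinarith
  · calc ‖p • (x - y) - κ • y‖ ≤ ‖p • (x - y)‖ + ‖κ • y‖ := norm_sub_le _ _
      _ = p * ‖x - y‖ + κ * ‖y‖ := by
        rw [norm_smul, norm_smul, Real.norm_of_nonneg hp0, Real.norm_eq_abs,
          ← abs_of_nonneg h0, abs_mul, abs_norm]
      _ ≤ 2 * p * ‖x - y‖ := by
        have h7 : (2 - α) * p ≤ 1 * p := mul_le_mul_of_nonneg_right (by linarith) hp0
        have h8 : p * (‖x‖ - ‖y‖) ≤ p * ‖x - y‖ := mul_le_mul_of_nonneg_left hd hp0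
        nlinarith

lemma powGrad_monotone {α : ℝ} (hα₁ : 1 < α) (hα₂ : α ≤ 2) (x y : E) :
    0 ≤ inner ℝ (x - y) (powGrad α x - powGrad α y) := by
  wlog h : ‖y‖ ≤ ‖x‖ generalizing x y
  · have := this y x (le_of_not_ge h)
    rwa [← neg_sub x y, ← neg_sub (powGrad α x), inner_neg_neg] at this
  refine le_trans ?_ (powGrad_sub_bounds hα₁ hα₂ h).1
  have : 0 ≤ α - 1 := by linarith
  positivity

/-- `v` is, up to an error of size `1`, the vector of length `Q` in the direction of `u`. -/
def Aligned (Q : ℝ) (u v : E) : Prop := ‖v - (Q / ‖u‖) • u‖ ≤ 1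

/-- Increments of the gradient along nearly parallel vectors are bounded below. -/
lemma inner_powGrad_sub_ge {α : ℝ} (hα₁ : 1 < α) (hα₂ : α ≤ 2) {Q R : ℝ}
    (hQ : 4 ≤ (α - 1) * Q) {x y v : E} (hR : 1 ≤ R) (hx : ‖x‖ ≤ R) (hy : ‖y‖ ≤ R)
    (hv : Aligned Q (x - y) v) :
    ‖x - y‖ / R ≤ inner ℝ v (powGrad α x - powGrad α y) := by
  rcases eq_or_ne x y with rfl | hxy
  · simp
  have hpos : 0 < ‖x - y‖ := norm_pos_iff.2 (sub_ne_zero.2 hxy)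
  have key : ∃ a, 0 < a ∧ a ≤ R ∧
      (α - 1) * a ^ (α - 2) * ‖x - y‖ ^ 2 ≤ inner ℝ (x - y) (powGrad α x - powGrad α y) ∧
      ‖powGrad α x - powGrad α y‖ ≤ 2 * a ^ (α - 2) * ‖x - y‖ := by
    rcases le_total ‖y‖ ‖x‖ with h | h
    · refine ⟨‖x‖, ?_, hx, powGrad_sub_bounds hα₁ hα₂ h⟩
      rcases (norm_nonneg x).eq_or_lt with h0 | h0
      · rw [← h0] at h
        exact absurd ((norm_eq_zero.1 h0.symm).trans (norm_le_zero_iff.1 h).symm) hxy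
      · exact h0
    · have := powGrad_sub_bounds hα₁ hα₂ h
      rw [norm_sub_rev y x, norm_sub_rev (powGrad α y), ← neg_sub x y,
        ← neg_sub (powGrad α x), inner_neg_neg] at this
      refine ⟨‖y‖, ?_, hy, this⟩
      rcases (norm_nonneg y).eq_or_lt with h0 | h0
      · rw [← h0] at h
        exact absurd ((norm_le_zero_iff.1 h).trans (norm_eq_zero.1 h0.symm).symm) hxy
      · exact h0
  obtain ⟨a, ha0, haR, h1, h2⟩ := key
  set G := powGrad α x - powGrad α y
  set p := a ^ (α - 2)
  have hp : R⁻¹ ≤ p := by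
    rw [← Real.rpow_neg_one]
    calc R ^ (-1 : ℝ) ≤ R ^ (α - 2) := Real.rpow_le_rpow_of_exponent_le hR (by linarith)
      _ ≤ p := Real.rpow_le_rpow_of_nonpos ha0 haR (by linarith)
  have hR0 : 0 < R⁻¹ := by positivity
  have e : inner ℝ v G = Q / ‖x - y‖ * inner ℝ (x - y) G
      + inner ℝ (v - (Q / ‖x - y‖) • (x - y)) G := by
    rw [inner_sub_left v, real_inner_smul_left]; ring
  have h3 : -(2 * p * ‖x - y‖) ≤ inner ℝ (v - (Q / ‖x - y‖) • (x - y)) G := by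
    have h4 := abs_real_inner_le_norm (v - (Q / ‖x - y‖) • (x - y)) G
    have h5 : ‖v - (Q / ‖x - y‖) • (x - y)‖ * ‖G‖ ≤ 1 * ‖G‖ :=
      mul_le_mul_of_nonneg_right hv (norm_nonneg _)
    have := neg_abs_le (inner ℝ (v - (Q / ‖x - y‖) • (x - y)) G)
    linarith
  have hQ0 : 0 < Q := pos_of_mul_pos_right (by linarith : 0 < (α - 1) * Q) (by linarith)
  have h4 : 4 * p * ‖x - y‖ ≤ Q / ‖x - y‖ * inner ℝ (x - y) G := by
    calc 4 * p * ‖x - y‖ ≤ (α - 1) * Q * p * ‖x - y‖ := by gcongr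
      _ = Q / ‖x - y‖ * ((α - 1) * p * ‖x - y‖ ^ 2) := by field_simp
      _ ≤ _ := by gcongr
  rw [e, div_eq_mul_inv]
  nlinarith

lemma hasDerivAt_norm_rpow_line {α : ℝ} (hα : 1 < α) (x v : E) (t : ℝ) :
    HasDerivAt (fun s : ℝ => ‖x + s • v‖ ^ α) (α * inner ℝ v (powGrad α (x + t • v))) t := by
  have h1 : HasDerivAt (fun s : ℝ => x + s • v) v t := by
    simpa using ((hasDerivAt_id t).smul_const v).const_add x
  have h2 := (hasFDerivAt_norm_rpow (x + t • v) hα).comp_hasDerivAt t h1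
  refine h2.congr_deriv ?_
  change α * ‖x + t • v‖ ^ (α - 2) * inner ℝ (x + t • v) v = _
  rw [powGrad, real_inner_smul_right, real_inner_comm]
  ring

lemma norm_add_smul_le {x v : E} {A j t : ℝ} (ht : 0 ≤ t) (htj : t ≤ j) (hx : ‖x‖ ≤ A)
    (hx' : ‖x + j • v‖ ≤ A) : ‖x + t • v‖ ≤ A := by
  rcases ht.eq_or_lt with rfl | ht0
  · simpa using hx
  have hj : 0 < j := ht0.trans_le htj
  have h := (convex_closedBall (0 : E) A) (x := x) (y := x + j • v) (by simpa using hx)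
    (by simpa using hx') (a := 1 - t / j) (b := t / j)
    (by rw [sub_nonneg, div_le_one hj]; exact htj) (by positivity) (by ring)
  have e : (1 - t / j) • x + (t / j) • (x + j • v) = x + t • v := by
    rw [smul_add, smul_smul, div_mul_cancel₀ _ hj.ne']; module
  rw [e] at h
  simpa using h

lemma diff_norm_rpow_increment {α : ℝ} (hα₁ : 1 < α) (hα₂ : α ≤ 2) {Q R A j : ℝ}
    (hQ : 4 ≤ (α - 1) * Q) {x m v : E} (hR : 1 ≤ R) (hAR : A + ‖m‖ ≤ R) (hj : 0 < j)
    (hx : ‖x‖ ≤ A) (hx' : ‖x + j • v‖ ≤ A) (hv : Aligned Q m v) :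
    j * ‖m‖ / R ≤ (‖x + j • v + m‖ ^ α - ‖x + j • v‖ ^ α) - (‖x + m‖ ^ α - ‖x‖ ^ α) := by
  have hd : ∀ t : ℝ, HasDerivAt (fun s : ℝ => ‖x + m + s • v‖ ^ α - ‖x + s • v‖ ^ α)
      (α * inner ℝ v (powGrad α (x + m + t • v)) - α * inner ℝ v (powGrad α (x + t • v))) t :=
    fun t => (hasDerivAt_norm_rpow_line hα₁ _ v t).sub (hasDerivAt_norm_rpow_line hα₁ _ v t)
  obtain ⟨t, ht, h⟩ := exists_hasDerivAt_eq_slope _ _ hj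
    (fun t _ => (hd t).continuousAt.continuousWithinAt) (fun t _ => hd t)
  have hxt : ‖x + t • v‖ ≤ A := norm_add_smul_le ht.1.le ht.2.le hx hx'
  have hm : ‖x + m + t • v‖ ≤ R := by
    rw [add_right_comm]
    linarith [norm_add_le (x + t • v) m]
  have e : x + m + t • v - (x + t • v) = m := by abel
  have h1 := inner_powGrad_sub_ge hα₁ hα₂ hQ hR hm
    (show ‖x + t • v‖ ≤ R by linarith [norm_nonneg m]) (by rwa [e])
  rw [e, inner_sub_right] at h1
  rw [eq_div_iff (by linarith)] at h
  simp only [zero_smul, add_zero, sub_zero] at h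
  rw [add_right_comm x (j • v) m, ← h]
  have h2 : 0 ≤ ‖m‖ / R := by positivity
  have h3 : j * ‖m‖ / R = ‖m‖ / R * j := by ring
  rw [h3]
  refine mul_le_mul_of_nonneg_right ?_ hj.le
  nlinarith

lemma norm_rpow_tangent_le {α : ℝ} (hα₁ : 1 < α) (hα₂ : α ≤ 2) {j : ℝ} (hj : 0 < j) (x v : E) :
    j * (α * inner ℝ v (powGrad α x)) ≤ ‖x + j • v‖ ^ α - ‖x‖ ^ α := by
  obtain ⟨t, ht, h⟩ := exists_hasDerivAt_eq_slope _ _ hj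
    (fun t _ => (hasDerivAt_norm_rpow_line hα₁ x v t).continuousAt.continuousWithinAt)
    (fun t _ => hasDerivAt_norm_rpow_line hα₁ x v t)
  rw [eq_div_iff (by linarith)] at h
  simp only [zero_smul, add_zero, sub_zero] at h
  rw [← h, mul_comm]
  have h1 := powGrad_monotone hα₁ hα₂ (x + t • v) x
  rw [add_sub_cancel_left, real_inner_smul_left, inner_sub_right] at h1
  have h2 := nonneg_of_mul_nonneg_right h1 ht.1
  refine mul_le_mul_of_nonneg_right ?_ hj.le
  exact mul_le_mul_of_nonneg_left (by linarith) (by linarith)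

lemma sum_norm_rpow_increment {α : ℝ} (hα₁ : 1 < α) (hα₂ : α ≤ 2) {Q R A j : ℝ}
    (hQ : 4 ≤ (α - 1) * Q) {x m v : E} (hR : 1 ≤ R) (hAR : A + ‖m‖ ≤ R) (hj : 0 < j)
    (hx : ‖x‖ ≤ A) (hv : Aligned Q ((2 : ℝ) • x + m) v) :
    j * ‖(2 : ℝ) • x + m‖ / R ≤
      (‖x + j • v + m‖ ^ α + ‖x + j • v‖ ^ α) - (‖x + m‖ ^ α + ‖x‖ ^ α) := by
  have e : x + m - -x = (2 : ℝ) • x + m := by module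
  have h1 := inner_powGrad_sub_ge hα₁ hα₂ hQ hR
    (show ‖x + m‖ ≤ R by linarith [norm_add_le x m])
    (show ‖-x‖ ≤ R by rw [norm_neg]; linarith [norm_nonneg m]) (by rwa [e])
  have h2 := norm_rpow_tangent_le hα₁ hα₂ hj (x + m) v
  have h3 := norm_rpow_tangent_le hα₁ hα₂ hj x v
  rw [e, inner_sub_right] at h1
  have e2 : powGrad α (-x) = -powGrad α x := by simp [powGrad]
  rw [e2, inner_neg_right, sub_neg_eq_add] at h1
  rw [add_right_comm x (j • v) m]
  have h4 : j * ‖(2 : ℝ) • x + m‖ / R = j * (‖(2 : ℝ) • x + m‖ / R) := by ring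
  have h6 : 0 ≤ ‖(2 : ℝ) • x + m‖ / R := by positivity
  rw [h4]
  have h5 : j * (‖(2 : ℝ) • x + m‖ / R) ≤
      j * (α * (inner ℝ v (powGrad α (x + m)) + inner ℝ v (powGrad α x))) := by
    refine mul_le_mul_of_nonneg_left ?_ hj.le
    nlinarith
  linarith

end InnerProduct

section Counting

open Finset

lemma sum_piFinset_split {ι β M : Type*} [Fintype ι] [DecidableEq ι] [Zero β] [AddCommMonoid M]
    (D : ι → Finset β) (i : ι) (H : (ι → β) → M) :
    ∑ n ∈ Fintype.piFinset D, H n =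
      ∑ n ∈ Fintype.piFinset (Function.update D i {0}), ∑ y ∈ D i, H (Function.update n i y) := by
  rw [← Finset.sum_product']
  refine Finset.sum_nbij' (fun n => (Function.update n i 0, n i))
    (fun p => Function.update p.1 i p.2) ?_ ?_ ?_ ?_ ?_
  · intro n hn
    rw [Fintype.mem_piFinset] at hn
    simp only [mem_product, Fintype.mem_piFinset]
    refine ⟨fun l => ?_, hn i⟩
    rcases eq_or_ne l i with rfl | h
    · simp
    · simpa [h] using hn l
  · rintro ⟨n, y⟩ h
    simp only [mem_product, Fintype.mem_piFinset] at h ⊢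
    intro l
    rcases eq_or_ne l i with rfl | hl
    · simpa using h.2
    · simpa [hl] using h.1 l
  · intro n _
    simp
  · rintro ⟨n, y⟩ h
    simp only [mem_product, Fintype.mem_piFinset] at h
    have h0 : n i = 0 := by simpa using h.1 i
    simp [← h0]
  · intro n _
    simp

/-- The weight `max(1, |t|) ^ (-1/2)`. -/
def invSqrtWeight (t : ℤ) : ℝ := (√(max 1 |(t : ℝ)|))⁻¹

lemma invSqrtWeight_nonneg (t : ℤ) : 0 ≤ invSqrtWeight t := by
  unfold invSqrtWeight; positivity

lemma inv_sqrt_le_invSqrtWeight {t : ℤ} {r : ℝ} (h1 : 1 ≤ r) (ht : |(t : ℝ)| ≤ r) :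
    (√r)⁻¹ ≤ invSqrtWeight t := by
  unfold invSqrtWeight
  gcongr
  exact max_le h1 ht

lemma sum_invSqrtWeight_Icc (N : ℕ) :
    ∑ t ∈ Icc (-(N : ℤ)) N, invSqrtWeight t ≤ 1 + 4 * √N := by
  induction N with
  | zero => simp [invSqrtWeight]
  | succ N ih =>
    have hsub : Icc (-((N + 1 : ℕ) : ℤ)) ((N + 1 : ℕ) : ℤ) ⊆
        insert ((N : ℤ) + 1) (insert (-((N : ℤ) + 1)) (Icc (-(N : ℤ)) N)) := by
      intro t ht
      simp only [mem_insert, mem_Icc] at ht ⊢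
      omega
    have h1 : invSqrtWeight ((N : ℤ) + 1) = (√((N : ℝ) + 1))⁻¹ := by
      unfold invSqrtWeight
      push_cast
      rw [abs_of_nonneg (by positivity), max_eq_right (by linarith [N.cast_nonneg (α := ℝ)])]
    have h2 : invSqrtWeight (-((N : ℤ) + 1)) = (√((N : ℝ) + 1))⁻¹ := by
      rw [← h1]; unfold invSqrtWeight; push_cast; rw [abs_neg]
    have h3 : ∑ t ∈ Icc (-((N + 1 : ℕ) : ℤ)) ((N + 1 : ℕ) : ℤ), invSqrtWeight t ≤
        (√((N : ℝ) + 1))⁻¹ + ((√((N : ℝ) + 1))⁻¹ + ∑ t ∈ Icc (-(N : ℤ)) N, invSqrtWeight t) := by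
      refine (sum_le_sum_of_subset_of_nonneg hsub fun t _ _ => invSqrtWeight_nonneg t).trans ?_
      rw [sum_insert, sum_insert, h1, h2]
      · simp
      · simp only [mem_insert, mem_Icc]; omega
    have h4 : (√((N : ℝ) + 1))⁻¹ ≤ 2 * (√((N : ℝ) + 1) - √N) := by
      have ha : 0 < √((N : ℝ) + 1) := by positivity
      have hb : 0 ≤ √(N : ℝ) := by positivity
      have hab : √(N : ℝ) ≤ √((N : ℝ) + 1) := Real.sqrt_le_sqrt (by linarith)
      have ea : √((N : ℝ) + 1) ^ 2 = N + 1 := Real.sq_sqrt (by positivity)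
      have eb : √(N : ℝ) ^ 2 = N := Real.sq_sqrt (by positivity)
      rw [inv_le_iff_one_le_mul₀ ha]
      nlinarith
    push_cast at h3 ⊢
    linarith

/-- Rearrangement bound: among sets of given cardinality the sum of the weight is largest on
intervals around the origin. -/
lemma sum_invSqrtWeight_le {E : Finset ℤ} {N : ℕ} (hN : 1 ≤ N) (hE : #E ≤ N) :
    ∑ t ∈ E, invSqrtWeight t ≤ 6 * √N := by
  have hs : 1 ≤ √(N : ℝ) := Real.one_le_sqrt.2 (by exact_mod_cast hN)
  have h1 : ∀ t ∈ E, invSqrtWeight t ≤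
      (if t ∈ Icc (-(N : ℤ)) N then invSqrtWeight t else 0) + (√(N : ℝ))⁻¹ := by
    intro t _
    split_ifs with h
    · have : 0 ≤ (√(N : ℝ))⁻¹ := by positivity
      linarith
    · rw [zero_add]
      unfold invSqrtWeight
      gcongr
      refine le_max_of_le_right ?_
      have : (N : ℤ) ≤ |t| := by
        simp only [mem_Icc, not_and_or, not_le] at h
        rcases h with h | h
        · exact le_trans (by omega) (neg_le_abs t)
        · exact le_trans (by omega) (le_abs_self t)
      exact_mod_cast this
  refine (sum_le_sum h1).trans ?_
  rw [sum_add_distrib, sum_const, nsmul_eq_mul, ← sum_filter]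
  have h2 : ∑ t ∈ E with t ∈ Icc (-(N : ℤ)) N, invSqrtWeight t ≤ 1 + 4 * √N := by
    refine le_trans ?_ (sum_invSqrtWeight_Icc N)
    refine sum_le_sum_of_subset_of_nonneg ?_ fun t _ _ => invSqrtWeight_nonneg t
    intro t ht
    exact (mem_filter.1 ht).2
  have h3 : (#E : ℝ) * (√(N : ℝ))⁻¹ ≤ √N := by
    rw [← div_eq_mul_inv, div_le_iff₀ (by linarith), Real.mul_self_sqrt (by positivity)]
    exact_mod_cast hE
  linarith

lemma sum_invSqrtWeight_affine_le {a : ℤ} (ha : a ≠ 0) (b : ℤ) {N : ℕ} (hN : 1 ≤ N) :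
    ∑ t ∈ Icc (-(N : ℤ)) N, invSqrtWeight (a * t + b) ≤ 18 * √N := by
  have hinj : Function.Injective fun t : ℤ => a * t + b := fun s t h => by
    simpa [ha] using h
  have h := sum_invSqrtWeight_le (E := (Icc (-(N : ℤ)) N).image fun t => a * t + b) (N := 9 * N)
    (by omega) (card_image_le.trans (by simp; omega))
  rw [sum_image hinj.injOn] at h
  refine h.trans_eq ?_
  push_cast
  rw [Real.sqrt_mul (by norm_num), show (9 : ℝ) = 3 ^ 2 by norm_num,
    Real.sqrt_sq (by norm_num)]
  ring

/-- The representative of the line `n + ℤ v` with `i`-th coordinate in `[0, |v i|)`. -/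
def lineKey (v : Fin 3 → ℤ) (i : Fin 3) (n : Fin 3 → ℤ) : Fin 3 → ℤ := n - (n i / v i) • v

lemma card_le_sum_lines (T Z : Finset (Fin 3 → ℤ)) (v : Fin 3 → ℤ) (i : Fin 3)
    (L : (Fin 3 → ℤ) → ℝ) (hZ : ∀ n ∈ T, lineKey v i n ∈ Z) (hL0 : ∀ z ∈ Z, 0 ≤ L z)
    (hL : ∀ n ∈ T, ∀ j : ℤ, 0 < j → n + j • v ∈ T → (j : ℝ) ≤ L (lineKey v i n)) :
    (#T : ℝ) ≤ ∑ z ∈ Z, (1 + L z) := by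
  rw [card_eq_sum_card_fiberwise (f := lineKey v i) (t := Z) hZ]
  push_cast
  refine sum_le_sum fun z hz => ?_
  set Tz := {n ∈ T | lineKey v i n = z}
  rcases Tz.eq_empty_or_nonempty with h | h
  · rw [h]; simp; linarith [hL0 z hz]
  obtain ⟨n₀, hn₀, hmin⟩ := Tz.exists_min_image (fun n => n i / v i) h
  have hrec : ∀ n ∈ Tz, n - (n i / v i) • v = z := fun n hn => (mem_filter.1 hn).2
  have hmaps : Set.MapsTo (fun n : Fin 3 → ℤ => n i / v i) Tz
      (Icc (n₀ i / v i) (n₀ i / v i + ⌊L z⌋)) := by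
    intro n hn
    rw [mem_coe] at hn
    rw [mem_coe, mem_Icc]
    refine ⟨hmin n hn, ?_⟩
    rcases (hmin n hn).eq_or_lt with h' | h'
    · change n i / v i ≤ _
      rw [← h', le_add_iff_nonneg_right]
      exact Int.floor_nonneg.2 (hL0 z hz)
    · have e : n₀ + (n i / v i - n₀ i / v i) • v = n := by
        rw [sub_smul, ← add_sub_assoc, add_sub_right_comm, hrec n₀ hn₀, ← hrec n hn,
          sub_add_cancel]
      have := hL n₀ (mem_filter.1 hn₀).1 (n i / v i - n₀ i / v i) (by linarith)
        (by rw [e]; exact (mem_filter.1 hn).1)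
      rw [(mem_filter.1 hn₀).2] at this
      have := Int.le_floor.2 this
      linarith
  have hcard := card_le_card_of_injOn _ hmaps fun n hn n' hn' h' => by
    have e := (hrec n hn).trans (hrec n' hn').symm
    change n i / v i = n' i / v i at h'
    rw [h'] at e
    exact sub_left_inj.1 e
  rw [Int.card_Icc] at hcard
  have h0 : 0 ≤ ⌊L z⌋ := Int.floor_nonneg.2 (hL0 z hz)
  have : (#Tz : ℤ) ≤ ⌊L z⌋ + 1 := by omega
  have : (#Tz : ℝ) ≤ (⌊L z⌋ : ℝ) + 1 := by exact_mod_cast this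
  linarith [Int.floor_le (L z)]

end Counting

section Lattice

open Finset

/-- A lattice point as a point of Euclidean space. -/
def latticeVec (n : Fin 3 → ℤ) : EuclideanSpace ℝ (Fin 3) := WithLp.toLp 2 fun i => (n i : ℝ)

lemma latticeVec_add (m n : Fin 3 → ℤ) : latticeVec (m + n) = latticeVec m + latticeVec n := by
  ext i; simp [latticeVec]

lemma latticeVec_zsmul (j : ℤ) (n : Fin 3 → ℤ) :
    latticeVec (j • n) = (j : ℝ) • latticeVec n := by
  ext i; simp [latticeVec]

lemma norm_latticeVec (n : Fin 3 → ℤ) : ‖latticeVec n‖ = znorm n := by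
  simp [latticeVec, znorm, EuclideanSpace.norm_eq]

lemma abs_coord_le_znorm (n : Fin 3 → ℤ) (i : Fin 3) : |(n i : ℝ)| ≤ znorm n := by
  rw [znorm, ← Real.sqrt_sq_eq_abs]
  exact Real.sqrt_le_sqrt
    (single_le_sum (f := fun i => (n i : ℝ) ^ 2) (fun _ _ => sq_nonneg _) (mem_univ i))

lemma one_le_znorm {n : Fin 3 → ℤ} (hn : n ≠ 0) : 1 ≤ znorm n := by
  obtain ⟨i, hi⟩ := Function.ne_iff.1 hn
  refine le_trans ?_ (abs_coord_le_znorm n i)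
  exact_mod_cast Int.one_le_abs hi

lemma latticeVec_ne_zero {n : Fin 3 → ℤ} (hn : n ≠ 0) : latticeVec n ≠ 0 := by
  rw [← norm_pos_iff, norm_latticeVec]
  linarith [one_le_znorm hn]

/-- The lattice points of a cube centred at the origin. -/
def latticeBox (M : ℕ) : Finset (Fin 3 → ℤ) := Fintype.piFinset fun _ => Icc (-(M : ℤ)) M

lemma mem_latticeBox {M : ℕ} {n : Fin 3 → ℤ} : n ∈ latticeBox M ↔ ∀ l, |n l| ≤ M := by
  simp [latticeBox, abs_le]

lemma mem_latticeBox_of_znorm_le {M : ℕ} {n : Fin 3 → ℤ} (h : znorm n ≤ M) :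
    n ∈ latticeBox M := by
  rw [mem_latticeBox]
  intro l
  exact_mod_cast (abs_coord_le_znorm n l).trans h

lemma card_latticeBox (M : ℕ) : (#(latticeBox M) : ℝ) = (2 * M + 1) ^ 3 := by
  have h : ((M : ℤ) + 1 + M).toNat = 2 * M + 1 := by omega
  simp [latticeBox, Fintype.card_piFinset, h]

lemma card_latticeBox_le {M : ℕ} (hM : 1 ≤ M) : (#(latticeBox M) : ℝ) ≤ 27 * (M : ℝ) ^ 3 := by
  rw [card_latticeBox]
  have : (1 : ℝ) ≤ M := by exact_mod_cast hM
  calc (2 * (M : ℝ) + 1) ^ 3 ≤ (3 * M) ^ 3 := by gcongr; linarith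
    _ = _ := by ring

lemma exists_aligned_lattice {Q : ℝ} (hQ : 1 < Q) {M : ℕ} (hM : Q + 1 ≤ M)
    {u : EuclideanSpace ℝ (Fin 3)} (hu : u ≠ 0) :
    ∃ v ∈ latticeBox M, v ≠ 0 ∧ Aligned Q u (latticeVec v) := by
  set w := (Q / ‖u‖) • u with hw
  have hnw : ‖w‖ = Q := by
    have : ‖u‖ ≠ 0 := norm_ne_zero_iff.2 hu
    rw [hw, norm_smul, Real.norm_of_nonneg (by positivity), div_mul_cancel₀ _ this]
  set v : Fin 3 → ℤ := fun i => round (w i) with hv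
  have hal : ‖latticeVec v - w‖ ≤ 1 := by
    rw [EuclideanSpace.norm_eq]
    refine Real.sqrt_le_one.2 ?_
    have : ∀ i, ‖(latticeVec v - w) i‖ ^ 2 ≤ 1 / 4 := fun i => by
      have h := abs_sub_round (w i)
      rw [abs_sub_comm] at h
      have e : (latticeVec v - w) i = (round (w i) : ℝ) - w i := by simp [latticeVec, hv]
      rw [e, Real.norm_eq_abs]
      nlinarith [abs_nonneg ((round (w i) : ℝ) - w i)]
    calc _ ≤ ∑ _i : Fin 3, (1 / 4 : ℝ) := sum_le_sum fun i _ => this i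
      _ ≤ 1 := by norm_num
  refine ⟨v, mem_latticeBox_of_znorm_le ?_, ?_, hal⟩
  · rw [← norm_latticeVec]
    have := norm_sub_norm_le (latticeVec v) w
    linarith
  · intro h0
    have e : latticeVec v = 0 := by rw [h0]; ext i; simp [latticeVec]
    rw [e, zero_sub, norm_neg] at hal
    linarith

/-- A box containing the representatives of all lines in direction `v` that meet a cube. -/
def keyBox (M R : ℕ) (i : Fin 3) : Finset (Fin 3 → ℤ) :=
  Fintype.piFinset (Function.update (fun _ => Icc (-(R : ℤ)) R) i (Icc 0 (M : ℤ)))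

lemma lineKey_mem_keyBox {M A : ℕ} {v n : Fin 3 → ℤ} {i : Fin 3} (hi : v i ≠ 0)
    (hv : v ∈ latticeBox M) (hn : n ∈ latticeBox A) :
    lineKey v i n ∈ keyBox M ((M + 1) * A) i := by
  rw [mem_latticeBox] at hv hn
  rw [keyBox, Fintype.mem_piFinset]
  intro l
  rcases eq_or_ne l i with rfl | hl
  · have e : lineKey v l n l = n l % v l := by
      simp [lineKey, Int.emod_def, mul_comm]
    rw [e]
    simp only [Function.update_self, mem_Icc]
    exact ⟨Int.emod_nonneg _ hi, (Int.emod_lt_abs _ hi).le.trans (hv l)⟩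
  · simp only [ne_eq, hl, not_false_eq_true, Function.update_of_ne, mem_Icc, ← abs_le]
    have e : lineKey v i n l = n l - n i / v i * v l := by simp [lineKey]
    rw [e]
    calc |n l - n i / v i * v l| ≤ |n l| + |n i / v i| * |v l| := by
          rw [← abs_mul]; exact abs_sub _ _
      _ ≤ A + A * M := by
          gcongr
          · exact hn l
          · exact (Int.abs_ediv_le_abs _ _).trans (hn i)
          · exact hv l
      _ = _ := by push_cast; ring

lemma card_keyBox_le (M : ℕ) {R : ℕ} (hR : 1 ≤ R) (i : Fin 3) :
    (#(keyBox M R i) : ℝ) ≤ (M + 1) * (9 * (R : ℝ) ^ 2) := by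
  have h : ((R : ℤ) + 1 + R).toNat = 2 * R + 1 := by omega
  have hR' : (1 : ℝ) ≤ R := by exact_mod_cast hR
  have e : (#(keyBox M R i) : ℝ) = (M + 1) * (2 * R + 1) ^ 2 := by
    rw [keyBox, Fintype.card_piFinset]
    fin_cases i <;> simp [Fin.prod_univ_three, Function.update, h] <;> ring
  rw [e]
  gcongr
  nlinarith

/-- The coordinates of `v i • u - u i • v`, which are constant along lines in direction `v`. -/
def transverse (v : Fin 3 → ℤ) (i : Fin 3) (u : Fin 3 → ℤ) (l : Fin 3) : ℤ :=
  v i * u l - u i * v l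

lemma transverse_lineKey (v : Fin 3 → ℤ) (i : Fin 3) (n m : Fin 3 → ℤ) (l : Fin 3) :
    transverse v i ((2 : ℤ) • lineKey v i n + m) l = transverse v i ((2 : ℤ) • n + m) l := by
  simp [transverse, lineKey]
  ring

lemma sum_keyBox_transverse_le {M R : ℕ} (hR : 1 ≤ R) {v : Fin 3 → ℤ} {i : Fin 3}
    (hi : v i ≠ 0) (m : Fin 3 → ℤ) :
    ∑ z ∈ keyBox M R i, ∏ l ∈ univ.erase i,
      invSqrtWeight (transverse v i ((2 : ℤ) • z + m) l) ≤ (M + 1) * (324 * R) := by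
  rw [keyBox, sum_piFinset_split _ i, sum_comm, Function.update_self, Function.update_idem]
  have key : ∀ y ∈ Icc (0 : ℤ) M,
      ∑ z ∈ Fintype.piFinset (Function.update (fun _ => Icc (-(R : ℤ)) R) i {0}),
        ∏ l ∈ univ.erase i, invSqrtWeight
          (transverse v i ((2 : ℤ) • (Function.update z i y) + m) l) ≤ 324 * R := by
    intro y _
    set h : Fin 3 → ℤ → ℝ := fun l t =>
      if l = i then 1 else invSqrtWeight (2 * v i * t + (v i * m l - (2 * y + m i) * v l)) with hh
    have e : ∀ z : Fin 3 → ℤ, ∏ l ∈ univ.erase i, invSqrtWeight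
        (transverse v i ((2 : ℤ) • (Function.update z i y) + m) l) = ∏ l, h l (z l) := by
      intro z
      rw [← mul_prod_erase univ _ (mem_univ i)]
      have : h i (z i) = 1 := by simp [hh]
      rw [this, one_mul]
      refine prod_congr rfl fun l hl => ?_
      have hl' : l ≠ i := (mem_erase.1 hl).1
      simp only [hh, hl', if_false]
      congr 1
      simp [transverse, hl']
      ring
    simp_rw [e]
    rw [← prod_univ_sum, ← mul_prod_erase univ _ (mem_univ i)]
    have h1 : ∑ t ∈ Function.update (fun _ => Icc (-(R : ℤ)) R) i {0} i, h i t = 1 := by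
      simp [hh]
    rw [h1, one_mul]
    calc _ ≤ ∏ _l ∈ univ.erase i, (18 * √(R : ℝ)) := by
          refine prod_le_prod (fun l _ => sum_nonneg fun t _ => ?_) fun l hl => ?_
          · simp only [hh]; split_ifs
            · exact zero_le_one
            · exact invSqrtWeight_nonneg _
          · have hl' : l ≠ i := (mem_erase.1 hl).1
            simp only [hh, hl', if_false, ne_eq, not_false_eq_true, Function.update_of_ne]
            exact sum_invSqrtWeight_affine_le (mul_ne_zero two_ne_zero hi) _ hR
      _ = 324 * R := by
          rw [prod_const, card_erase_of_mem (mem_univ i), card_univ, Fintype.card_fin, mul_pow,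
            Real.sq_sqrt (by positivity)]
          norm_num
  refine (sum_le_sum key).trans_eq ?_
  rw [sum_const, Int.card_Icc, nsmul_eq_mul]
  have : ((M : ℤ) + 1 - 0).toNat = M + 1 := by omega
  rw [this]
  push_cast
  ring

lemma prod_transverse_ge {M : ℕ} (hM : 1 ≤ M) {v u : Fin 3 → ℤ} (hv : v ∈ latticeBox M)
    (hu : u ≠ 0) (i : Fin 3) :
    (znorm u)⁻¹ ≤ 2 * M * ∏ l ∈ univ.erase i, invSqrtWeight (transverse v i u l) := by
  rw [mem_latticeBox] at hv
  have hM' : (1 : ℝ) ≤ M := by exact_mod_cast hM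
  have h1 := one_le_znorm hu
  set r := 2 * M * znorm u with hr
  have hr1 : 1 ≤ r := by nlinarith
  have hv' : ∀ l, |(v l : ℝ)| ≤ M := fun l => by exact_mod_cast hv l
  have hw : ∀ l, (√r)⁻¹ ≤ invSqrtWeight (transverse v i u l) := fun l => by
    refine inv_sqrt_le_invSqrtWeight hr1 ?_
    simp only [transverse]
    push_cast
    calc |(v i : ℝ) * u l - u i * v l| ≤ |(v i : ℝ)| * |(u l : ℝ)| + |(u i : ℝ)| * |(v l : ℝ)| := by
          rw [← abs_mul, ← abs_mul]; exact abs_sub _ _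
      _ ≤ M * znorm u + znorm u * M := by
          gcongr
          · exact hv' i
          · exact abs_coord_le_znorm u l
          · exact abs_coord_le_znorm u i
          · exact hv' l
      _ = r := by rw [hr]; ring
  have h2 : r⁻¹ ≤ ∏ l ∈ univ.erase i, invSqrtWeight (transverse v i u l) := by
    calc r⁻¹ = ∏ _l ∈ univ.erase i, (√r)⁻¹ := by
          rw [prod_const, card_erase_of_mem (mem_univ i), card_univ, Fintype.card_fin, inv_pow,
            Real.sq_sqrt (by positivity)]
      _ ≤ _ := prod_le_prod (fun _ _ => by positivity) fun l _ => hw l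
  calc (znorm u)⁻¹ = 2 * M * r⁻¹ := by rw [hr]; field_simp
    _ ≤ _ := by gcongr

/-- Counting a set whose consecutive points on each line in a given direction are limited. -/
lemma card_le_of_steps_le {T : Finset (Fin 3 → ℤ)} {M A : ℕ} (hA : 1 ≤ A)
    (hT : T ⊆ latticeBox A) {v : Fin 3 → ℤ} (hv : v ∈ latticeBox M) (hv0 : v ≠ 0) {L : ℝ}
    (hL0 : 0 ≤ L) (hL : ∀ n ∈ T, ∀ j : ℤ, 0 < j → n + j • v ∈ T → (j : ℝ) ≤ L) :
    (#T : ℝ) ≤ 9 * ((M : ℝ) + 1) ^ 3 * A ^ 2 * (1 + L) := by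
  obtain ⟨i, hi⟩ := Function.ne_iff.1 hv0
  refine (card_le_sum_lines T (keyBox M ((M + 1) * A) i) v i (fun _ => L)
    (fun n hn => lineKey_mem_keyBox hi hv (hT hn)) (fun _ _ => hL0) hL).trans ?_
  rw [sum_const, nsmul_eq_mul]
  refine (mul_le_mul_of_nonneg_right (card_keyBox_le M (by nlinarith) i)
    (by linarith)).trans_eq ?_
  push_cast
  ring

/-- Counting a set whose consecutive points `n` on each line in direction `v` are limited in terms
of `|2n + m|`. -/
lemma card_le_of_steps_le_div {T : Finset (Fin 3 → ℤ)} {M A : ℕ} (hA : 1 ≤ A) (hM : 1 ≤ M)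
    (hT : T ⊆ latticeBox A) {v : Fin 3 → ℤ} (hv : v ∈ latticeBox M) (hv0 : v ≠ 0)
    {m : Fin 3 → ℤ} {K : ℝ} (hK : 0 ≤ K) (hm : ∀ n ∈ T, (2 : ℤ) • n + m ≠ 0)
    (hL : ∀ n ∈ T, ∀ j : ℤ, 0 < j → n + j • v ∈ T →
      (j : ℝ) ≤ K * A * (znorm ((2 : ℤ) • n + m))⁻¹) :
    (#T : ℝ) ≤ ((M : ℝ) + 1) ^ 3 * A ^ 2 * (9 + 648 * K) := by
  obtain ⟨i, hi⟩ := Function.ne_iff.1 hv0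
  have hR : 1 ≤ (M + 1) * A := by nlinarith
  refine (card_le_sum_lines T (keyBox M ((M + 1) * A) i) v i
    (fun z => K * A * (2 * M) * ∏ l ∈ univ.erase i,
      invSqrtWeight (transverse v i ((2 : ℤ) • z + m) l))
    (fun n hn => lineKey_mem_keyBox hi hv (hT hn)) ?_ ?_).trans ?_
  · intro z _
    have := prod_nonneg (s := univ.erase i) fun l _ =>
      invSqrtWeight_nonneg (transverse v i ((2 : ℤ) • z + m) l)
    positivity
  · intro n hn j hj hjn
    refine (hL n hn j hj hjn).trans ?_
    simp_rw [transverse_lineKey]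
    rw [mul_assoc (K * A)]
    exact mul_le_mul_of_nonneg_left (prod_transverse_ge hM hv (hm n hn) i) (by positivity)
  · rw [sum_add_distrib, ← mul_sum, sum_const, nsmul_eq_mul, mul_one]
    have h1 := card_keyBox_le M hR i
    have h2 := mul_le_mul_of_nonneg_left (sum_keyBox_transverse_le (M := M) hR hi m)
      (show 0 ≤ K * A * (2 * M) by positivity)
    refine (add_le_add h1 h2).trans ?_
    push_cast
    have h3 : (M : ℝ) * (M + 1) ^ 2 ≤ (M + 1) ^ 3 := by nlinarith [M.cast_nonneg (α := ℝ)]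
    have h4 : 0 ≤ 648 * K * (A : ℝ) ^ 2 := by positivity
    nlinarith [mul_le_mul_of_nonneg_left h3 h4]

end Lattice

section LevelSets

open Finset

lemma inv_znorm_le_weights {m : Fin 3 → ℤ} (hm : m ≠ 0) :
    (znorm m)⁻¹ ≤ invSqrtWeight (m 0) * invSqrtWeight (m 1) := by
  have h1 := one_le_znorm hm
  have e : (znorm m)⁻¹ = (√(znorm m))⁻¹ * (√(znorm m))⁻¹ := by
    rw [← mul_inv, Real.mul_self_sqrt (by linarith)]
  rw [e]
  have h := fun l => inv_sqrt_le_invSqrtWeight h1 (abs_coord_le_znorm m l)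
  exact mul_le_mul (h 0) (h 1) (by positivity) (invSqrtWeight_nonneg _)

lemma card_diff_level_le {α : ℝ} (hα₁ : 1 < α) (hα₂ : α ≤ 2) {Q κ W : ℝ} {M A : ℕ}
    (hQ : 4 ≤ (α - 1) * Q) (hQ1 : 1 < Q) (hM : Q + 1 ≤ M) (hκ : 0 ≤ κ) (hW : 0 ≤ W) (hA : 1 ≤ A)
    {m : Fin 3 → ℤ} (hm : znorm m ≤ κ * A) (hm0 : m ≠ 0) {T : Finset (Fin 3 → ℤ)}
    (hT : ∀ n ∈ T, znorm n ≤ A)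
    (hg : ∀ n ∈ T, ∀ n' ∈ T,
      (znorm (n' + m) ^ α - znorm n' ^ α) - (znorm (n + m) ^ α - znorm n ^ α) ≤ W) :
    (#T : ℝ) ≤ 9 * ((M : ℝ) + 1) ^ 3 * A ^ 2 * (1 + W * (1 + κ) * A * (znorm m)⁻¹) := by
  obtain ⟨v, hvM, hv0, hv⟩ := exists_aligned_lattice hQ1 hM (latticeVec_ne_zero hm0)
  have hA' : (1 : ℝ) ≤ A := by exact_mod_cast hA
  have hm1 := one_le_znorm hm0
  have hR : (0 : ℝ) < (1 + κ) * A := by positivity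
  refine card_le_of_steps_le hA (fun n hn => mem_latticeBox_of_znorm_le (hT n hn)) hvM hv0
    (by positivity) fun n hn j hj hjn => ?_
  have hjn' := hT _ hjn
  have h1 := hg n hn _ hjn
  simp only [← norm_latticeVec, latticeVec_add, latticeVec_zsmul] at h1 hjn'
  have h2 := diff_norm_rpow_increment hα₁ hα₂ (R := (1 + κ) * A) (A := A) (j := j) hQ (by nlinarith)
    (by rw [norm_latticeVec]; linarith) (by exact_mod_cast hj)
    (by rw [norm_latticeVec]; exact hT n hn) hjn' hv
  have h3 := h2.trans h1
  rw [div_le_iff₀ hR, norm_latticeVec] at h3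
  rw [← div_eq_mul_inv, le_div_iff₀ (by linarith)]
  linarith

lemma card_sum_level_le {α : ℝ} (hα₁ : 1 < α) (hα₂ : α ≤ 2) {Q κ W : ℝ} {M A : ℕ}
    (hQ : 4 ≤ (α - 1) * Q) (hQ1 : 1 < Q) (hM : Q + 1 ≤ M) (hκ : 0 ≤ κ) (hW : 0 ≤ W) (hA : 1 ≤ A)
    {m : Fin 3 → ℤ} (hm : znorm m ≤ κ * A) {T : Finset (Fin 3 → ℤ)}
    (hT : ∀ n ∈ T, znorm n ≤ A)
    (hg : ∀ n ∈ T, ∀ n' ∈ T,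
      (znorm (n' + m) ^ α + znorm n' ^ α) - (znorm (n + m) ^ α + znorm n ^ α) ≤ W) :
    (#T : ℝ) ≤ 1 + (2 * M + 1) ^ 3 *
      (((M : ℝ) + 1) ^ 3 * A ^ 2 * (9 + 648 * (W * (1 + κ)))) := by
  classical
  have hA' : (1 : ℝ) ≤ A := by exact_mod_cast hA
  have hM1 : 1 ≤ M := by
    have : (1 : ℝ) ≤ M := by linarith
    exact_mod_cast this
  have hR : (0 : ℝ) < (1 + κ) * A := by positivity
  set Tv : (Fin 3 → ℤ) → Finset (Fin 3 → ℤ) := fun v =>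
    {n ∈ T | (2 : ℤ) • n + m ≠ 0 ∧ Aligned Q (latticeVec ((2 : ℤ) • n + m)) (latticeVec v)} with hTv
  set V := {v ∈ latticeBox M | v ≠ 0} with hV
  have hcov : T ⊆ {n ∈ T | (2 : ℤ) • n + m = 0} ∪ V.biUnion Tv := by
    intro n hn
    rw [mem_union]
    by_cases h : (2 : ℤ) • n + m = 0
    · exact Or.inl (mem_filter.2 ⟨hn, h⟩)
    · obtain ⟨v, hvM, hv0, hv⟩ := exists_aligned_lattice hQ1 hM (latticeVec_ne_zero h)
      exact Or.inr (mem_biUnion.2 ⟨v, mem_filter.2 ⟨hvM, hv0⟩, mem_filter.2 ⟨hn, h, hv⟩⟩)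
  have hone : #{n ∈ T | (2 : ℤ) • n + m = 0} ≤ 1 := by
    rw [card_le_one]
    intro n hn n' hn'
    have h := (mem_filter.1 hn).2.trans (mem_filter.1 hn').2.symm
    ext l
    have := congrFun (add_right_cancel h) l
    simpa using this
  have hTvcard : ∀ v ∈ V,
      (#(Tv v) : ℝ) ≤ ((M : ℝ) + 1) ^ 3 * A ^ 2 * (9 + 648 * (W * (1 + κ))) := by
    intro v hv
    obtain ⟨hvM, hv0⟩ := mem_filter.1 hv
    refine card_le_of_steps_le_div (m := m) hA hM1
      (fun n hn => mem_latticeBox_of_znorm_le (hT n (mem_filter.1 hn).1)) hvM hv0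
      (by positivity) (fun n hn => (mem_filter.1 hn).2.1) fun n hn j hj hjn => ?_
    obtain ⟨hnT, hu0, hal⟩ := mem_filter.1 hn
    have h1 := hg n hnT _ (mem_filter.1 hjn).1
    have hu1 := one_le_znorm hu0
    have e : latticeVec ((2 : ℤ) • n + m) = (2 : ℝ) • latticeVec n + latticeVec m := by
      rw [latticeVec_add, latticeVec_zsmul]; norm_num
    rw [e] at hal
    simp only [← norm_latticeVec, latticeVec_add, latticeVec_zsmul] at h1
    have h2 := sum_norm_rpow_increment hα₁ hα₂ (R := (1 + κ) * A) (A := A) (j := j) hQ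
      (by nlinarith) (by rw [norm_latticeVec]; linarith) (by exact_mod_cast hj)
      (by rw [norm_latticeVec]; exact hT n hnT) hal
    have h3 := h2.trans h1
    rw [div_le_iff₀ hR, ← e, norm_latticeVec] at h3
    rw [← div_eq_mul_inv, le_div_iff₀ (by linarith)]
    linarith
  have hV' : (#V : ℝ) ≤ (2 * M + 1) ^ 3 := by
    rw [← card_latticeBox]
    exact_mod_cast card_filter_le _ _
  have h1 : #T ≤ 1 + ∑ v ∈ V, #(Tv v) :=
    (card_le_card hcov).trans ((card_union_le _ _).trans (add_le_add hone card_biUnion_le))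
  calc (#T : ℝ) ≤ 1 + ∑ v ∈ V, (#(Tv v) : ℝ) := by exact_mod_cast h1
    _ ≤ 1 + ∑ _v ∈ V, ((M : ℝ) + 1) ^ 3 * A ^ 2 * (9 + 648 * (W * (1 + κ))) := by
        gcongr with v hv
        exact hTvcard v hv
    _ ≤ _ := by
        rw [sum_const, nsmul_eq_mul]
        gcongr

/-- Level sets of `n ↦ |n + m| ^ α ± |n| ^ α` in a ball of radius `A`. -/
lemma exists_card_level_le {α : ℝ} (hα₁ : 1 < α) (hα₂ : α ≤ 2) {κ W : ℝ} (hκ : 0 ≤ κ)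
    (hW : 0 ≤ W) :
    ∃ C : ℝ, 0 < C ∧ ∀ σ : ℝ, IsSign σ → ∀ A : ℕ, 1 ≤ A → ∀ m : Fin 3 → ℤ, znorm m ≤ κ * A →
      ∀ T : Finset (Fin 3 → ℤ), (∀ n ∈ T, znorm n ≤ A) →
        (∀ n ∈ T, ∀ n' ∈ T,
          (znorm (n' + m) ^ α + σ * znorm n' ^ α) - (znorm (n + m) ^ α + σ * znorm n ^ α) ≤ W) →
        (#T : ℝ) ≤ C * (A ^ 2 + A ^ 3 * (invSqrtWeight (m 0) * invSqrtWeight (m 1))) := by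
  set Q := 4 / (α - 1) with hQdef
  have hα : 0 < α - 1 := by linarith
  have hQ : 4 ≤ (α - 1) * Q := by rw [hQdef, mul_div_cancel₀ _ hα.ne']
  have hQ1 : 1 < Q := by rw [hQdef, lt_div_iff₀ hα]; linarith
  set M := ⌈Q + 1⌉₊
  have hM : Q + 1 ≤ M := Nat.le_ceil _
  set C₁ := 9 * ((M : ℝ) + 1) ^ 3 * (1 + W * (1 + κ)) with hC₁
  set C₂ := (2 * (M : ℝ) + 1) ^ 3 * (((M : ℝ) + 1) ^ 3 * (9 + 648 * (W * (1 + κ)))) with hC₂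
  have hC₁0 : 0 ≤ C₁ := by positivity
  have hC₂0 : 0 ≤ C₂ := by positivity
  refine ⟨28 + C₁ + C₂, by positivity, fun σ hσ A hA m hm T hT hg => ?_⟩
  have hA' : (1 : ℝ) ≤ A := by exact_mod_cast hA
  set w := invSqrtWeight (m 0) * invSqrtWeight (m 1) with hw
  have hw0 : 0 ≤ w := mul_nonneg (invSqrtWeight_nonneg _) (invSqrtWeight_nonneg _)
  have hX : 0 ≤ (A : ℝ) ^ 2 + A ^ 3 * w := by positivity
  rcases hσ with rfl | rfl
  · have h := card_sum_level_le hα₁ hα₂ hQ hQ1 hM hκ hW hA hm hT (by simpa using hg)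
    have e : (1 : ℝ) + (2 * M + 1) ^ 3 * (((M : ℝ) + 1) ^ 3 * A ^ 2 * (9 + 648 * (W * (1 + κ))))
        = 1 + C₂ * A ^ 2 := by rw [hC₂]; ring
    rw [e] at h
    calc (#T : ℝ) ≤ 1 + C₂ * A ^ 2 := h
      _ ≤ (28 + C₂) * A ^ 2 := by nlinarith
      _ ≤ (28 + C₁ + C₂) * (A ^ 2 + A ^ 3 * w) := by
          gcongr
          · linarith
          · have : 0 ≤ (A : ℝ) ^ 3 * w := by positivity
            linarith
  · rcases eq_or_ne m 0 with rfl | hm0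
    · have hw1 : w = 1 := by simp [hw, invSqrtWeight]
      have hsub : T ⊆ latticeBox A := fun n hn => mem_latticeBox_of_znorm_le (hT n hn)
      calc (#T : ℝ) ≤ #(latticeBox A) := by exact_mod_cast card_le_card hsub
        _ ≤ 27 * (A : ℝ) ^ 3 := card_latticeBox_le hA
        _ ≤ (28 + C₁ + C₂) * (A ^ 2 + A ^ 3 * w) := by
            rw [hw1]
            gcongr
            · linarith
            · have : 0 ≤ (A : ℝ) ^ 2 := by positivity
              linarith
    · have h := card_diff_level_le hα₁ hα₂ hQ hQ1 hM hκ hW hA hm hm0 hT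
        (by simpa [← sub_eq_add_neg] using hg)
      calc (#T : ℝ) ≤ 9 * ((M : ℝ) + 1) ^ 3 * A ^ 2 * (1 + W * (1 + κ) * A * (znorm m)⁻¹) := h
        _ ≤ 9 * ((M : ℝ) + 1) ^ 3 * A ^ 2 * (1 + W * (1 + κ) * A * w) := by
            gcongr
            exact inv_znorm_le_weights hm0
        _ ≤ C₁ * (A ^ 2 + A ^ 3 * w) := by
            have h1 : 1 + W * (1 + κ) * A * w ≤ (1 + W * (1 + κ)) * (1 + A * w) := by
              have h2 : 0 ≤ W * (1 + κ) := by positivity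
              have h3 : 0 ≤ A * w := by positivity
              nlinarith
            calc _ ≤ 9 * ((M : ℝ) + 1) ^ 3 * A ^ 2 * ((1 + W * (1 + κ)) * (1 + A * w)) := by gcongr
              _ = _ := by rw [hC₁]; ring
        _ ≤ _ := by
            gcongr
            linarith

lemma abs_jbb_sub_le {α : ℝ} (hα₁ : 1 < α) (hα₂ : α ≤ 2) (n : Fin 3 → ℤ) :
    |jbb α n - znorm n ^ α| ≤ 1 := by
  set s := ∑ i, ((n i : ℝ)) ^ 2 with hs
  have hs0 : 0 ≤ s := sum_nonneg fun _ _ => sq_nonneg _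
  have hz : znorm n ^ α = s ^ (α / 2) := by
    rw [znorm, ← hs, Real.sqrt_eq_rpow, ← Real.rpow_mul hs0]; ring_nf
  have hj : jb n ^ α = (1 + s) ^ (α / 2) := by
    rw [jb, ← hs, Real.sqrt_eq_rpow, ← Real.rpow_mul (by linarith)]; ring_nf
  have hj2 : jb n ^ (2 * α) = (jb n ^ α) ^ 2 := by
    rw [mul_comm, Real.rpow_mul (show 0 ≤ jb n from Real.sqrt_nonneg _)]; norm_num
  have h1 : (1 + s) ^ (α / 2) ≤ 1 + s ^ (α / 2) := by
    simpa using Real.rpow_add_le_add_rpow zero_le_one hs0 (by linarith : 0 ≤ α / 2) (by linarith)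
  have h2 : s ^ (α / 2) ≤ (1 + s) ^ (α / 2) :=
    Real.rpow_le_rpow hs0 (by linarith) (by linarith)
  have h3 : 1 ≤ (1 + s) ^ (α / 2) := Real.one_le_rpow (by linarith) (by linarith)
  rw [jbb, hj2, hj, hz]
  set J := (1 + s) ^ (α / 2)
  have h4 : √(J ^ 2 - 1 / 4) ≤ J := by
    rw [Real.sqrt_le_left (by linarith)]; linarith
  have h5 : J - 1 / 2 ≤ √(J ^ 2 - 1 / 4) := Real.le_sqrt_of_sq_le (by nlinarith)
  rw [abs_le]
  constructor <;> linarith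

end LevelSets

section Assembly

open Finset

lemma znorm_le_of_mem_latticeBox {M : ℕ} {n : Fin 3 → ℤ} (hn : n ∈ latticeBox M) :
    znorm n ≤ 3 * M := by
  rw [mem_latticeBox] at hn
  have h : ∀ l, (n l : ℝ) ^ 2 ≤ (M : ℝ) ^ 2 := fun l => by
    rw [sq_le_sq, Nat.abs_cast]
    exact_mod_cast hn l
  refine Real.sqrt_le_iff.2 ⟨by positivity, ?_⟩
  rw [Fin.sum_univ_three]
  nlinarith [h 0, h 1, h 2]

lemma znorm_sum_le {k : ℕ} (n : Fin k → Fin 3 → ℤ) : znorm (∑ j, n j) ≤ ∑ j, znorm (n j) := by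
  have e : latticeVec (∑ j, n j) = ∑ j, latticeVec (n j) := by
    ext i; simp [latticeVec]
  simp only [← norm_latticeVec, e]
  exact norm_sum_le _ _

lemma sum_update_of_eq_zero {k : ℕ} {n : Fin k → Fin 3 → ℤ} {a : Fin k} (h : n a = 0)
    (y : Fin 3 → ℤ) : ∑ j, Function.update n a y j = y + ∑ j, n j := by
  rw [sum_update_of_mem (mem_univ a), ← add_sum_erase univ n (mem_univ a), h, zero_add,
    sdiff_singleton_eq_erase]

lemma sum_latticeBox_weights_le {B : ℕ} (hB : 1 ≤ B) (c : Fin 3 → ℤ) :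
    ∑ y ∈ latticeBox B, invSqrtWeight ((y + c) 0) * invSqrtWeight ((y + c) 1) ≤
      972 * (B : ℝ) ^ 2 := by
  set h : Fin 3 → ℤ → ℝ := ![fun t => invSqrtWeight (1 * t + c 0),
    fun t => invSqrtWeight (1 * t + c 1), fun _ => 1] with hh
  have e : ∀ y : Fin 3 → ℤ, invSqrtWeight ((y + c) 0) * invSqrtWeight ((y + c) 1) =
      ∏ l, h l (y l) := fun y => by simp [hh, Fin.prod_univ_three]
  simp_rw [e]
  rw [latticeBox, ← prod_univ_sum, Fin.prod_univ_three]
  have h0 := sum_invSqrtWeight_affine_le one_ne_zero (c 0) hB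
  have h1 := sum_invSqrtWeight_affine_le one_ne_zero (c 1) hB
  have h2 : ∑ t ∈ Icc (-(B : ℤ)) B, h 2 t ≤ 3 * B := by
    have : ((B : ℤ) + 1 + B).toNat ≤ 3 * B := by omega
    simp only [hh, Matrix.cons_val, sum_const, Int.card_Icc, sub_neg_eq_add, nsmul_eq_mul, mul_one]
    exact_mod_cast this
  have p1 : 0 ≤ ∑ t ∈ Icc (-(B : ℤ)) B, h 1 t := sum_nonneg fun t _ => invSqrtWeight_nonneg _
  have p2 : 0 ≤ ∑ t ∈ Icc (-(B : ℤ)) B, h 2 t := sum_nonneg fun t _ => zero_le_one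
  calc _ ≤ (18 * √(B : ℝ)) * (18 * √(B : ℝ)) * (3 * B) :=
        mul_le_mul (mul_le_mul h0 h1 p1 (by positivity)) h2 p2 (by positivity)
    _ = 972 * (B : ℝ) ^ 2 := by
        have := Real.mul_self_sqrt (Nat.cast_nonneg (α := ℝ) B)
        linear_combination 972 * (B : ℝ) * this

lemma SimFreq.znorm_le {N : ℕ} (hN : 1 ≤ N) {n : Fin 3 → ℤ} (h : SimFreq N n) : znorm n ≤ N := by
  rcases h with h | h
  · exact h.2.2
  · exact h.2.trans (by exact_mod_cast hN)

/-- Varying one frequency changes the phase by the increment of a two-term phase. -/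
lemma two_term_increment_le {α : ℝ} (hα₁ : 1 < α) (hα₂ : α ≤ 2) {k : ℕ} {εsum : ℝ}
    {ε : Fin k → ℝ} (hs : IsSign εsum) {a : Fin k} (ha : IsSign (ε a)) {ζ : ℝ}
    {w : Fin k → Fin 3 → ℤ} (hw : w a = 0) {y y' : Fin 3 → ℤ}
    (hy : |phase α εsum ε (Function.update w a y) - ζ| ≤ 1)
    (hy' : |phase α εsum ε (Function.update w a y') - ζ| ≤ 1) :
    (znorm (y' + ∑ j, w j) ^ α + εsum * ε a * znorm y' ^ α) -
      (znorm (y + ∑ j, w j) ^ α + εsum * ε a * znorm y ^ α) ≤ 6 := by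
  have e : ∀ x, phase α εsum ε (Function.update w a x) = εsum * jbb α (x + ∑ j, w j) +
      (ε a * jbb α x + ∑ j ∈ univ.erase a, ε j * jbb α (w j)) := by
    intro x
    rw [phase, sum_update_of_eq_zero hw,
      ← add_sum_erase univ (fun j => ε j * jbb α (Function.update w a x j)) (mem_univ a),
      Function.update_self]
    congr 2
    refine sum_congr rfl fun j hj => ?_
    rw [Function.update_of_ne (mem_erase.1 hj).1]
  rw [e, abs_le] at hy hy'
  have h1 := abs_le.1 (abs_jbb_sub_le hα₁ hα₂ (y + ∑ j, w j))
  have h2 := abs_le.1 (abs_jbb_sub_le hα₁ hα₂ (y' + ∑ j, w j))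
  have h3 := abs_le.1 (abs_jbb_sub_le hα₁ hα₂ y)
  have h4 := abs_le.1 (abs_jbb_sub_le hα₁ hα₂ y')
  rcases hs with rfl | rfl <;> rcases ha with ha | ha <;> rw [ha] at hy hy' ⊢ <;> linarith

lemma prod_update_update_card_le {k : ℕ} {N : Fin k → ℕ} (hN : ∀ j, 1 ≤ N j) {a b : Fin k}
    (hab : a ≠ b) :
    (#(Fintype.piFinset (Function.update (Function.update (fun j => latticeBox (N j)) a {0}) b
      {0})) : ℝ) * ((N a : ℝ) ^ 3 * (N b : ℝ) ^ 3) ≤ 27 ^ k * ∏ j, (N j : ℝ) ^ 3 := by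
  rw [Fintype.card_piFinset]
  push_cast
  have e : (N a : ℝ) ^ 3 * (N b : ℝ) ^ 3 =
      ∏ j, (if j = a then (N a : ℝ) ^ 3 else 1) * (if j = b then (N b : ℝ) ^ 3 else 1) := by
    rw [prod_mul_distrib]; simp
  have e2 : (27 : ℝ) ^ k = ∏ _j : Fin k, (27 : ℝ) := by simp
  rw [e, e2, ← prod_mul_distrib, ← prod_mul_distrib]
  refine prod_le_prod (fun j _ => ?_) fun j _ => ?_
  · split_ifs <;> positivity
  · have hc := card_latticeBox_le (hN j)
    have hp : 0 ≤ (N j : ℝ) ^ 3 := by positivity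
    by_cases hb : j = b
    · subst hb
      simp only [Function.update_self, hab.symm, if_false, if_true, card_singleton]
      push_cast
      linarith
    · by_cases ha : j = a
      · subst ha
        simp only [Function.update_of_ne hb, Function.update_self, hb, if_false, if_true,
          card_singleton]
        push_cast
        linarith
      · simpa [Function.update_of_ne hb, Function.update_of_ne ha, ha, hb] using hc

lemma exists_top_two {k : ℕ} (hk : 2 ≤ k) (f : Fin k → ℝ) :
    ∃ a b : Fin k, a ≠ b ∧ (∀ j, f j ≤ f a) ∧ ∀ j, j ≠ a → f j ≤ f b := by
  have : Nontrivial (Fin k) := Fin.nontrivial_iff_two_le.2 hk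
  obtain ⟨a, -, ha⟩ := univ.exists_max_image f univ_nonempty
  obtain ⟨c, hc⟩ := exists_ne a
  obtain ⟨b, hb, hb'⟩ := (univ.erase a).exists_max_image f ⟨c, by simp [hc]⟩
  exact ⟨a, b, (mem_erase.1 hb).1.symm, fun j => ha j (mem_univ j),
    fun j hj => hb' j (by simp [hj])⟩

lemma secondMax_pos_and_le {k : ℕ} {f : Fin k → ℝ} (hf : ∀ j, 0 < f j) {a b : Fin k}
    (hab : a ≠ b) (hb : ∀ j, j ≠ a → f j ≤ f b) : 0 < secondMax f ∧ secondMax f ≤ f b := by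
  have hle : ∀ x ∈ {x : ℝ | ∃ i j : Fin k, i ≠ j ∧ x = min (f i) (f j)}, x ≤ f b := by
    rintro x ⟨i, j, hij, rfl⟩
    by_cases hi : i = a
    · exact (min_le_right _ _).trans (hb j fun hj => hij (hi.trans hj.symm))
    · exact (min_le_left _ _).trans (hb i hi)
  have hmem : min (f a) (f b) ∈ {x : ℝ | ∃ i j : Fin k, i ≠ j ∧ x = min (f i) (f j)} :=
    ⟨a, b, hab, rfl⟩
  exact ⟨(lt_min (hf a) (hf b)).trans_le (le_csSup ⟨f b, hle⟩ hmem), csSup_le ⟨_, hmem⟩ hle⟩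

end Assembly

/-- **General multilinear counting estimate** (Lemma 3.3): for `1 < α ≤ 2` and `k ≥ 3`
there is `C = C(α,k) > 0`, uniform in the choice of signs, such that for all dyadic
`N₁,…,N_k ≥ 1` and all `ζ ∈ ℝ`,
`#{ (n₁,…,n_k) : |n_j| ∼ N_j, |κ(n₁,…,n_k) − ζ| ≤ 1 } ≤ C · (max₍₂₎ N_j)⁻¹ · Π_j N_j³`. -/
theorem general_counting (α : ℝ) (hα₁ : 1 < α) (hα₂ : α ≤ 2) (k : ℕ) (hk : 3 ≤ k) :
    ∃ C : ℝ, 0 < C ∧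
      ∀ εsum : ℝ, IsSign εsum → ∀ ε : Fin k → ℝ, (∀ j, IsSign (ε j)) →
        ∀ Nv : Fin k → ℝ, (∀ j, IsDyadic (Nv j)) → ∀ ζ : ℝ,
          ∀ S : Set (Fin k → Fin 3 → ℤ),
            S = {n | (∀ j, SimFreq (Nv j) (n j)) ∧ |phase α εsum ε n - ζ| ≤ 1} →
            S.Finite ∧ (S.ncard : ℝ) ≤ C * (secondMax Nv)⁻¹ * ∏ j, Nv j ^ 3 := by
  classical
  obtain ⟨C, hC, hcount⟩ := exists_card_level_le hα₁ hα₂ (κ := 3 * k) (W := 6)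
    (by positivity) (by norm_num)
  refine ⟨C * 999 * 27 ^ k, by positivity, fun εsum hεsum ε hε Nv hNv ζ S hS => ?_⟩
  choose e he using hNv
  obtain ⟨N, hN⟩ : ∃ N : Fin k → ℕ, ∀ j, Nv j = N j := ⟨fun j => 2 ^ e j, fun j => by simp [he]⟩
  have hN1 : ∀ j, 1 ≤ N j := fun j => by
    have h : (1 : ℝ) ≤ N j := by rw [← hN, he]; exact one_le_pow₀ (by norm_num)
    exact_mod_cast h
  have hNpos : ∀ j, 0 < Nv j := fun j => by rw [hN]; exact_mod_cast hN1 j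
  obtain ⟨a, b, hab, ha, hb⟩ := exists_top_two (by omega) Nv
  obtain ⟨hsm0, hsm⟩ := secondMax_pos_and_le hNpos hab hb
  have hNa : ∀ j, N j ≤ N a := fun j => by
    have := ha j
    rw [hN, hN] at this
    exact_mod_cast this
  set D : Fin k → Finset (Fin 3 → ℤ) := fun j => latticeBox (N j) with hD
  have hSz : ∀ n ∈ S, ∀ j, znorm (n j) ≤ N j := fun n hn j => by
    rw [hS] at hn
    exact SimFreq.znorm_le (hN1 j) (hN j ▸ hn.1 j)
  have hSD : S ⊆ Fintype.piFinset D := fun n hn =>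
    Fintype.mem_piFinset.2 fun j => mem_latticeBox_of_znorm_le (hSz n hn j)
  refine ⟨(Finset.finite_toSet _).subset hSD, ?_⟩
  set G : (Fin 3 → ℤ) → ℝ := fun m =>
    C * ((N a : ℝ) ^ 2 + (N a : ℝ) ^ 3 * (invSqrtWeight (m 0) * invSqrtWeight (m 1))) with hG
  set A : ℝ := (N a : ℝ) with hA
  set B : ℝ := (N b : ℝ) with hB
  have hAB : B ≤ A := Nat.cast_le.2 (hNa b)
  have hB0 : 0 < B := Nat.cast_pos.2 (hN1 b)
  have hfiber : ∀ w ∈ Fintype.piFinset (Function.update D a {0}),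
      ∑ y ∈ D a, (if Function.update w a y ∈ S then (1 : ℝ) else 0) ≤ G (∑ j, w j) := by
    intro w hw
    rw [Fintype.mem_piFinset] at hw
    have hwa : w a = 0 := by simpa using hw a
    have hwj : ∀ j, znorm (w j) ≤ 3 * A := fun j => by
      rcases eq_or_ne j a with rfl | hj
      · rw [hwa]
        simp only [znorm, Pi.zero_apply, Int.cast_zero]
        norm_num
        positivity
      · have h := znorm_le_of_mem_latticeBox (M := N j) (by simpa [hj] using hw j)
        have : (N j : ℝ) ≤ A := Nat.cast_le.2 (hNa j)
        linarith
    rw [Finset.sum_boole]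
    refine hcount (εsum * ε a) ?_ (N a) (hN1 a) _ ?_ _ ?_ ?_
    · rcases hεsum with h | h <;> rcases hε a with h' | h' <;> simp [IsSign, h, h']
    · refine (znorm_sum_le w).trans ((Finset.sum_le_sum fun j _ => hwj j).trans_eq ?_)
      simp
      ring
    · intro y hy
      simpa using hSz _ (Finset.mem_filter.1 hy).2 a
    · intro y hy y' hy'
      have h := (Finset.mem_filter.1 hy).2
      have h' := (Finset.mem_filter.1 hy').2
      rw [hS] at h h'
      exact two_term_increment_le hα₁ hα₂ hεsum (hε a) hwa h.2 h'.2
  have hinner : ∀ c : Fin 3 → ℤ, ∑ y ∈ D b, G (y + c) ≤ C * 999 * (A ^ 3 * B ^ 2) := by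
    intro c
    have h1 := card_latticeBox_le (hN1 b)
    have h2 := sum_latticeBox_weights_le (hN1 b) c
    simp only [hG]
    rw [← Finset.mul_sum, Finset.sum_add_distrib, ← Finset.mul_sum, Finset.sum_const,
      nsmul_eq_mul, mul_assoc C]
    refine mul_le_mul_of_nonneg_left ?_ hC.le
    calc _ ≤ 27 * B ^ 3 * A ^ 2 + A ^ 3 * (972 * B ^ 2) := by gcongr
      _ ≤ 27 * (A * B ^ 2) * A ^ 2 + A ^ 3 * (972 * B ^ 2) := by
          gcongr
          nlinarith [sq_nonneg B]
      _ = _ := by ring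
  have hncard : (S.ncard : ℝ) =
      ∑ n ∈ Fintype.piFinset D, (if n ∈ S then (1 : ℝ) else 0) := by
    rw [Finset.sum_boole, ← Set.ncard_coe_finset]
    congr 2
    ext n
    simp only [Finset.coe_filter, Set.mem_ofPred_eq]
    exact ⟨fun h => ⟨hSD h, h⟩, fun h => h.2⟩
  set D' := Function.update D a {0} with hD'
  have hDb : D' b = D b := by rw [hD', Function.update_of_ne hab.symm]
  have hmain : (S.ncard : ℝ) ≤
      (Fintype.piFinset (Function.update D' b {0})).card * (C * 999 * (A ^ 3 * B ^ 2)) := by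
    rw [hncard, sum_piFinset_split D a]
    refine (Finset.sum_le_sum hfiber).trans ?_
    rw [sum_piFinset_split D' b, ← nsmul_eq_mul]
    refine Finset.sum_le_card_nsmul _ _ _ fun w hw => ?_
    have hwb : w b = 0 := by simpa using Fintype.mem_piFinset.1 hw b
    simp_rw [sum_update_of_eq_zero hwb, hDb]
    exact hinner _
  have hprod := prod_update_update_card_le hN1 hab
  have hinv : B⁻¹ ≤ (secondMax Nv)⁻¹ := by
    rw [hN b] at hsm
    exact inv_anti₀ hsm0 hsm
  calc (S.ncard : ℝ) ≤ _ := hmain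
    _ = C * 999 * B⁻¹ * ((Fintype.piFinset (Function.update D' b {0})).card *
          (A ^ 3 * B ^ 3)) := by field_simp
    _ ≤ C * 999 * B⁻¹ * (27 ^ k * ∏ j, (N j : ℝ) ^ 3) := by gcongr
    _ ≤ C * 999 * (secondMax Nv)⁻¹ * (27 ^ k * ∏ j, (N j : ℝ) ^ 3) := by gcongr
    _ = C * 999 * 27 ^ k * (secondMax Nv)⁻¹ * ∏ j, Nv j ^ 3 := by
        simp_rw [hN]
        ring
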